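/- arXiv:2107.03899 — 3 statements merged into one kernel-verified Lean document; each statement's English description precedes it below -/
import Mathlib

section
/- Let Ω ⊆ ℝ² be an open set, let λ : Ω → ℝ be differentiable with λ(x) > 0 for all x ∈ Ω, and let θ : Ω → ℝ be differentiable. If at every point of Ω the integrability (total-differential) conditions ∂/∂x₂((1/λ)·cos θ) = ∂/∂x₁((1/λ)·sin θ) and ∂/∂x₂(−(1/λ)·sin θ) = ∂/∂x₁((1/λ)·cos θ) hold, then at every point of Ω the pair (ln λ, θ) satisfies the Cauchy–Riemann equations: ∂(ln λ)/∂x₁ = ∂θ/∂x₂ and ∂(ln λ)/∂x₂ = −∂θ/∂x₁. -/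
/-- The derivative of `g / l` in terms of the logarithmic derivative of `l`. -/
theorem HasFDerivAt.one_div_mul_of_log {E : Type*} [NormedAddCommGroup E] [NormedSpace ℝ E]
    {l g : E → ℝ} {l' g' : E →L[ℝ] ℝ} {x : E}
    (hl : HasFDerivAt l l' x) (hg : HasFDerivAt g g' x) (hx : l x ≠ 0) :
    HasFDerivAt (fun y => (1 / l y) * g y) ((l x)⁻¹ • (g' - g x • (l x)⁻¹ • l')) x := by
  have hinv : HasFDerivAt (fun y => (l y)⁻¹) (-(l x ^ 2)⁻¹ • l') x :=
    (hasDerivAt_inv hx).comp_hasFDerivAt x hl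
  simp only [one_div]
  refine (hinv.mul hg).congr_fderiv ?_
  ext v
  simp
  field_simp
  ring

/-- An invertible rotation system has only the trivial solution. -/
theorem eq_zero_of_rotation_eq_zero {c s a b : ℝ} (hcs : c ^ 2 + s ^ 2 = 1)
    (h₁ : c * a - s * b = 0) (h₂ : s * a + c * b = 0) : a = 0 ∧ b = 0 :=
  ⟨by linear_combination (-a) * hcs + c * h₁ + s * h₂,
    by linear_combination (-b) * hcs - s * h₁ + c * h₂⟩

/-- If the total-differential (integrability) conditions for the conformal
cell-map differentials hold on an open set Ω ⊆ ℝ², then (ln λ, θ) satisfies the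
Cauchy–Riemann equations on Ω. -/
theorem integrability_implies_cauchy_riemann
    (Ω : Set (ℝ × ℝ)) (hΩ : IsOpen Ω)
    (lam θ : ℝ × ℝ → ℝ)
    (hlam : ∀ x ∈ Ω, DifferentiableAt ℝ lam x)
    (hpos : ∀ x ∈ Ω, 0 < lam x)
    (hθ : ∀ x ∈ Ω, DifferentiableAt ℝ θ x)
    (h1 : ∀ x ∈ Ω,
      fderiv ℝ (fun y => (1 / lam y) * Real.cos (θ y)) x ((0 : ℝ), (1 : ℝ))
        = fderiv ℝ (fun y => (1 / lam y) * Real.sin (θ y)) x ((1 : ℝ), (0 : ℝ)))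
    (h2 : ∀ x ∈ Ω,
      fderiv ℝ (fun y => -((1 / lam y) * Real.sin (θ y))) x ((0 : ℝ), (1 : ℝ))
        = fderiv ℝ (fun y => (1 / lam y) * Real.cos (θ y)) x ((1 : ℝ), (0 : ℝ))) :
    ∀ x ∈ Ω,
      fderiv ℝ (fun y => Real.log (lam y)) x ((1 : ℝ), (0 : ℝ)) = fderiv ℝ θ x ((0 : ℝ), (1 : ℝ))
      ∧ fderiv ℝ (fun y => Real.log (lam y)) x ((0 : ℝ), (1 : ℝ))
        = -fderiv ℝ θ x ((1 : ℝ), (0 : ℝ)) := by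
  intro x hx
  have hne := (hpos x hx).ne'
  have hl := (hlam x hx).hasFDerivAt
  have ht := (hθ x hx).hasFDerivAt
  have hcos := hl.one_div_mul_of_log ht.cos hne
  have hsin := hl.one_div_mul_of_log ht.sin hne
  have e1 := h1 x hx
  have e2 := h2 x hx
  rw [hcos.fderiv, hsin.fderiv] at e1
  rw [hsin.fun_neg.fderiv, hcos.fderiv] at e2
  rw [(hl.log hne).fderiv]
  simp only [neg_apply, smul_apply,
    sub_apply, smul_eq_mul, ← mul_neg] at e1 e2 ⊢
  replace e1 := mul_left_cancel₀ (inv_ne_zero hne) e1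
  replace e2 := mul_left_cancel₀ (inv_ne_zero hne) e2
  obtain ⟨ha, hb⟩ := eq_zero_of_rotation_eq_zero
    (a := (lam x)⁻¹ * fderiv ℝ lam x (0, 1) + fderiv ℝ θ x (1, 0))
    (b := (lam x)⁻¹ * fderiv ℝ lam x (1, 0) - fderiv ℝ θ x (0, 1))
    (Real.cos_sq_add_sin_sq (θ x)) (by linear_combination -e1) (by linear_combination e2)
  exact ⟨by linarith, by linarith⟩
end

section
/- Let C be a rank-4 tensor on ℝ² (C_{ijkl} ∈ ℝ for i,j,k,l ∈ {1,2}) and let R be a 2×2 real orthogonal matrix such that C is invariant under R: ∑_{a,b,c,d} R_{ia}R_{jb}R_{kc}R_{ld} C_{abcd} = C_{ijkl} for all i,j,k,l. Let χ : ℝ² → ℝ be continuously differentiable, let λ > 0, and let ξ̂ : ℝ² → ℝ (indexed as ξ̂_k^{st} for k,s,t ∈ {1,2}) be a twice continuously differentiable family of functions satisfying the matrix-cell problem: for all Ȳ ∈ ℝ² and all i, s, t, ∑_{j,k,l} ∂/∂Ȳ_j ( χ(Ȳ)·C_{ijkl}·∂ξ̂_k^{st}/∂Ȳ_l ) = ∑_j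 ∂(χ(Ȳ)·C_{ijst})/∂Ȳ_j. Define ξ_w^{uv}(Ȳ) = λ·∑_{s,t,k} R_{us}R_{vt}R_{wk}·ξ̂_k^{st}(Ȳ) and J_{mj} = (1/λ)·R_{jm}. Then ξ satisfies the transformed cell problem: for all Ȳ ∈ ℝ² and all i, s, t, ∑_{m,j} J_{mj}·∂/∂Ȳ_m ( ∑_{k,l,n} χ(Ȳ)·C_{ijkl}·J_{nl}·∂ξ_k^{st}/∂Ȳ_n ) = ∑_{m,j} J_{mj}·∂(χ(Ȳ)·C_{ijst})/∂Ȳ_m. -/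
open Matrix

/-- Partial derivative in the `i`-th coordinate direction of ℝ² (as `EuclideanSpace`). -/
noncomputable def pd (i : Fin 2) (f : EuclideanSpace ℝ (Fin 2) → ℝ)
    (Y : EuclideanSpace ℝ (Fin 2)) : ℝ :=
  fderiv ℝ f Y (EuclideanSpace.single i 1)

lemma pd_const_mul (i : Fin 2) (c : ℝ) {f : EuclideanSpace ℝ (Fin 2) → ℝ}
    {Y : EuclideanSpace ℝ (Fin 2)} (hf : DifferentiableAt ℝ f Y) :
    pd i (fun Y' => c * f Y') Y = c * pd i f Y := by
  simp [pd, fderiv_const_mul hf]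

lemma pd_sum {ι : Type*} [Fintype ι] (i : Fin 2) {f : ι → EuclideanSpace ℝ (Fin 2) → ℝ}
    {Y : EuclideanSpace ℝ (Fin 2)} (hf : ∀ a, DifferentiableAt ℝ (f a) Y) :
    pd i (fun Y' => ∑ a, f a Y') Y = ∑ a, pd i (f a) Y := by
  simp [pd, fderiv_fun_sum fun a _ => hf a]

lemma differentiable_pd {f : EuclideanSpace ℝ (Fin 2) → ℝ} (hf : ContDiff ℝ 2 f) (i : Fin 2) :
    Differentiable ℝ (pd i f) := by
  have h : ContDiff ℝ 1 (fderiv ℝ f) := hf.fderiv_right (by norm_num)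
  exact (h.differentiable (by norm_num)).clm_apply (differentiable_const _)

/-- An orthogonal change of coordinates is inverted by its transpose. -/
lemma sum_mul_eq_of_orthogonal {n : Type*} [Fintype n] [DecidableEq n] {R : Matrix n n ℝ}
    (hR : Rᵀ * R = 1) {f g : n → ℝ} (h : ∀ j, g j = ∑ b, R j b * f b) (m : n) :
    ∑ j, R j m * g j = f m := by
  have hg : g = R *ᵥ f := funext h
  have key : Rᵀ *ᵥ g = f := by rw [hg, mulVec_mulVec, hR, one_mulVec]
  exact congrFun key m

section InvariantTensor

variable {C : Fin 2 → Fin 2 → Fin 2 → Fin 2 → ℝ} {R : Matrix (Fin 2) (Fin 2) ℝ}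

lemma sum_second_index_of_invariant (hR : Rᵀ * R = 1)
    (hinv : ∀ i j k l,
      ∑ a : Fin 2, ∑ b : Fin 2, ∑ c : Fin 2, ∑ d : Fin 2,
        R i a * R j b * R k c * R l d * C a b c d = C i j k l) (i m s t : Fin 2) :
    ∑ j, R j m * C i j s t
      = ∑ a, R i a * ∑ p, ∑ q, R s p * R t q * C a m p q := by
  refine sum_mul_eq_of_orthogonal hR
    (f := fun b => ∑ a, R i a * ∑ p, ∑ q, R s p * R t q * C a b p q) (fun j => ?_) m
  rw [← hinv i j s t]
  simp only [Fin.sum_univ_two]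
  ring

lemma sum_last_indices_of_invariant (hR : Rᵀ * R = 1)
    (hinv : ∀ i j k l,
      ∑ a : Fin 2, ∑ b : Fin 2, ∑ c : Fin 2, ∑ d : Fin 2,
        R i a * R j b * R k c * R l d * C a b c d = C i j k l) (i m r n : Fin 2) :
    ∑ j, R j m * ∑ k, R k r * ∑ l, R l n * C i j k l = ∑ a, R i a * C a m r n := by
  refine sum_mul_eq_of_orthogonal hR (f := fun b => ∑ a, R i a * C a b r n) (fun j => ?_) m
  refine sum_mul_eq_of_orthogonal hR
    (f := fun c => ∑ b, R j b * ∑ a, R i a * C a b c n) (fun k => ?_) r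
  refine sum_mul_eq_of_orthogonal hR
    (f := fun d => ∑ c, R k c * ∑ b, R j b * ∑ a, R i a * C a b c d) (fun l => ?_) n
  rw [← hinv i j k l]
  simp only [Fin.sum_univ_two]
  ring

end InvariantTensor

/-- If the base elasticity tensor C is invariant under the orthogonal
matrix R, χ is C¹, and ξ̂ solves the matrix-cell problem (identity Jacobian), then
ξ_w^{uv} = λ·R_{us}R_{vt}R_{wk}·ξ̂_k^{st} solves the transformed cell problem with
conformal Jacobian J_{mj} = (1/λ)·R_{jm}. -/
theorem corrector_transformation_under_conformal_jacobian
    (C : Fin 2 → Fin 2 → Fin 2 → Fin 2 → ℝ)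
    (R : Matrix (Fin 2) (Fin 2) ℝ) (hR : Rᵀ * R = 1)
    (hinv : ∀ i j k l,
      ∑ a : Fin 2, ∑ b : Fin 2, ∑ c : Fin 2, ∑ d : Fin 2,
        R i a * R j b * R k c * R l d * C a b c d = C i j k l)
    (χ : EuclideanSpace ℝ (Fin 2) → ℝ) (hχ : ContDiff ℝ 1 χ)
    (lam : ℝ) (hlam : 0 < lam)
    (ξhat : Fin 2 → Fin 2 → Fin 2 → EuclideanSpace ℝ (Fin 2) → ℝ)
    (hξhat : ∀ k s t, ContDiff ℝ 2 (ξhat k s t))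
    (hcell : ∀ (Y : EuclideanSpace ℝ (Fin 2)) (i s t : Fin 2),
      ∑ j : Fin 2, ∑ k : Fin 2, ∑ l : Fin 2,
        pd j (fun Y' => χ Y' * C i j k l * pd l (ξhat k s t) Y') Y
      = ∑ j : Fin 2, pd j (fun Y' => χ Y' * C i j s t) Y)
    (ξ : Fin 2 → Fin 2 → Fin 2 → EuclideanSpace ℝ (Fin 2) → ℝ)
    (hξ : ∀ w u v Y, ξ w u v Y
      = lam * ∑ s : Fin 2, ∑ t : Fin 2, ∑ k : Fin 2,
          R u s * R v t * R w k * ξhat k s t Y)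
    (J : Fin 2 → Fin 2 → ℝ) (hJ : ∀ m j, J m j = (1 / lam) * R j m) :
    ∀ (Y : EuclideanSpace ℝ (Fin 2)) (i s t : Fin 2),
      ∑ m : Fin 2, ∑ j : Fin 2, J m j *
        pd m (fun Y' => ∑ k : Fin 2, ∑ l : Fin 2, ∑ nn : Fin 2,
          χ Y' * C i j k l * J nn l * pd nn (ξ k s t) Y') Y
      = ∑ m : Fin 2, ∑ j : Fin 2, J m j * pd m (fun Y' => χ Y' * C i j s t) Y := by
  intro Y i s t
  have hχd : Differentiable ℝ χ := hχ.differentiable (by norm_num)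
  have hξd : ∀ k s t, Differentiable ℝ (ξhat k s t) := fun k s t =>
    (hξhat k s t).differentiable (by norm_num)
  have hflux : ∀ n k s t, Differentiable ℝ (fun Y' => χ Y' * pd n (ξhat k s t) Y') :=
    fun n k s t => hχd.mul (differentiable_pd (hξhat k s t) n)
  set A : Fin 2 → Fin 2 → Fin 2 → Fin 2 → Fin 2 → ℝ :=
    fun m n r p q => pd m (fun Y' => χ Y' * pd n (ξhat r p q) Y') Y with hA
  have hrhs : ∀ m i j s t, pd m (fun Y' => χ Y' * C i j s t) Y = C i j s t * pd m χ Y := by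
    intro m i j s t
    simp only [mul_comm (χ _)]
    exact pd_const_mul m _ (hχd Y)
  have hcell' : ∀ a p q, ∑ m, ∑ r, ∑ n, C a m r n * A m n r p q
      = ∑ m, C a m p q * pd m χ Y := by
    intro a p q
    simp only [← hrhs, ← hcell Y a p q, hA]
    refine Finset.sum_congr rfl fun m _ => Finset.sum_congr rfl fun r _ =>
      Finset.sum_congr rfl fun n _ => ?_
    rw [← pd_const_mul m _ (hflux n r p q Y)]
    congr 1
    ext Y'
    ring
  have hpdξ : ∀ n k Y', pd n (ξ k s t) Y'
      = lam * ∑ p, ∑ q, ∑ r, R s p * R t q * R k r * pd n (ξhat r p q) Y' := by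
    intro n k Y'
    have hterm : ∀ p q r, Differentiable ℝ
        (fun Z => R s p * R t q * R k r * ξhat r p q Z) := fun p q r => (hξd r p q).const_mul _
    rw [show ξ k s t = _ from funext (hξ k s t), pd_const_mul n lam (by fun_prop),
      pd_sum n (by fun_prop)]
    congr 1
    refine Finset.sum_congr rfl fun p _ => ?_
    rw [pd_sum n (by fun_prop)]
    refine Finset.sum_congr rfl fun q _ => ?_
    rw [pd_sum n (by fun_prop)]
    exact Finset.sum_congr rfl fun r _ => pd_const_mul n _ (hξd r p q Y')
  set D : Fin 2 → Fin 2 → Fin 2 → ℝ :=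
    fun m n r => ∑ p, ∑ q, R s p * R t q * A m n r p q with hD
  have hlhs : ∀ m j, pd m (fun Y' => ∑ k, ∑ l, ∑ n,
        χ Y' * C i j k l * J n l * pd n (ξ k s t) Y') Y
      = ∑ k, ∑ l, ∑ n, C i j k l * R l n * ∑ r, R k r * D m n r := by
    intro m j
    have hfun : (fun Y' => ∑ k, ∑ l, ∑ n, χ Y' * C i j k l * J n l * pd n (ξ k s t) Y')
        = fun Y' => ∑ x : Fin 2 × Fin 2 × Fin 2 × Fin 2 × Fin 2 × Fin 2,
          (C i j x.1 x.2.1 * R x.2.1 x.2.2.1 *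
            (R x.1 x.2.2.2.1 * (R s x.2.2.2.2.1 * R t x.2.2.2.2.2))) *
          (χ Y' * pd x.2.2.1 (ξhat x.2.2.2.1 x.2.2.2.2.1 x.2.2.2.2.2) Y') := by
      ext Y'
      simp only [hpdξ, hJ, Fintype.sum_prod_type]
      refine Finset.sum_congr rfl fun k _ => Finset.sum_congr rfl fun l _ =>
        Finset.sum_congr rfl fun n _ => ?_
      simp only [Fin.sum_univ_two]
      field_simp
      ring
    rw [hfun, pd_sum m fun x => (hflux _ _ _ _ Y).const_mul _]
    simp only [pd_const_mul m _ (hflux _ _ _ _ Y)]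
    simp only [Fintype.sum_prod_type, hD, hA,
      Finset.mul_sum, mul_assoc]
  have hm := sum_second_index_of_invariant hR hinv i
  have hmrn := sum_last_indices_of_invariant hR hinv i
  simp only [hlhs, hrhs]
  simp only [hJ]
  calc ∑ m, ∑ j, 1 / lam * R j m * ∑ k, ∑ l, ∑ n, C i j k l * R l n * ∑ r, R k r * D m n r
      = 1 / lam * ∑ m, ∑ r, ∑ n,
          (∑ j, R j m * ∑ k, R k r * ∑ l, R l n * C i j k l) * D m n r := by
        simp only [Fin.sum_univ_two]
        ring
    _ = 1 / lam * ∑ a, R i a * ∑ p, ∑ q, R s p * R t q *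
          ∑ m, ∑ r, ∑ n, C a m r n * A m n r p q := by
        simp only [hmrn, hD]
        clear_value A
        simp only [Fin.sum_univ_two]
        ring
    _ = 1 / lam * ∑ m, (∑ a, R i a * ∑ p, ∑ q, R s p * R t q * C a m p q) * pd m χ Y := by
        simp only [hcell']
        simp only [Fin.sum_univ_two]
        ring
    _ = ∑ m, ∑ j, 1 / lam * R j m * (C i j s t * pd m χ Y) := by
        simp only [← hm]
        simp only [Fin.sum_univ_two]
        ring
end

section
/- Let C be a rank-4 tensor on ℝ² and R a 2×2 real orthogonal matrix such that ∑_{a,b,c,d} R_{ia}R_{jb}R_{kc}R_{ld} C_{abcd} = C_{ijkl} for all i,j,k,l. Let λ > 0, set J_{nt} = (1/λ)·R_{tn}, let S ⊆ ℝ² be a measurable set of finite measure, and let ξ̂ : ℝ² → ℝ (indexed as ξ̂_e^{cd}) be continuously differentiable with integrable partial derivatives on S. Define ξ_s^{kl}(Ȳ) = λ·∑_{e,c,d} R_{se}R_{kc}R_{ld}·ξ̂_e^{cd}(Ȳ), and define the two homogenised tensors Ĉ^H_{ijkl} = C_{ijkl}·vol(S) − ∑_{s,t} C_{ijst}·∫_S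 ∂ξ̂_s^{kl}/∂Ȳ_t dȲ and C^H_{ijkl} = C_{ijkl}·vol(S) − ∑_{s,t,n} C_{ijst}·J_{nt}·∫_S ∂ξ_s^{kl}/∂Ȳ_n dȲ. Then C^H_{ijkl} = ∑_{p,q,s,t} R_{ip}R_{jq}R_{ks}R_{lt}·Ĉ^H_{pqst} for all i,j,k,l; that is, the homogenised elasticity tensor of the rescaled and rotated cell is obtained by rotating the homogenised elasticity tensor of the matrix cell, independently of the scaling factor λ. -/
open Matrix MeasureTheory

/-- Partial differentiation commutes with finite linear combinations of `C¹` functions. -/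
theorem pd_const_mul_sum {ι : Type*} [Fintype ι] (n : Fin 2) (a : ℝ) (c : ι → ℝ)
    (f : ι → EuclideanSpace ℝ (Fin 2) → ℝ) (hf : ∀ x, ContDiff ℝ 1 (f x))
    (Y : EuclideanSpace ℝ (Fin 2)) :
    pd n (fun Z => a * ∑ x, c x * f x Z) Y = a * ∑ x, c x * pd n (f x) Y := by
  have h : HasFDerivAt (fun Z => a * ∑ x, c x * f x Z)
      (a • ∑ x, c x • fderiv ℝ (f x) Y) Y :=
    (HasFDerivAt.fun_sum fun x _ =>
      (((hf x).differentiable one_ne_zero) Y).hasFDerivAt.const_mul (c x)).const_mul a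
  simp [pd, h.fderiv]

/-- An orthogonal change of frame that fixes a rank-4 tensor can be moved from its last two
indices to its first two. -/
theorem sum_mul_orthogonal_eq_of_invariant
    (C : Fin 2 → Fin 2 → Fin 2 → Fin 2 → ℝ) (R : Matrix (Fin 2) (Fin 2) ℝ) (hR : Rᵀ * R = 1)
    (hinv : ∀ i j k l,
      ∑ a, ∑ b, ∑ c, ∑ d, R i a * R j b * R k c * R l d * C a b c d = C i j k l)
    (i j e n : Fin 2) :
    ∑ s, ∑ t, C i j s t * R s e * R t n = ∑ p, ∑ q, R i p * R j q * C p q e n := by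
  let N : Matrix (Fin 2) (Fin 2) ℝ := Matrix.of fun c d => ∑ p, ∑ q, R i p * R j q * C p q c d
  have hM : (Matrix.of fun s t => C i j s t) = R * N * Rᵀ := by
    ext s t
    simp only [Matrix.of_apply, ← hinv i j s t, Matrix.mul_apply, Matrix.transpose_apply, N,
      Fin.sum_univ_two]
    ring
  have hN : Rᵀ * (Matrix.of fun s t => C i j s t) * R = N := by
    rw [hM]
    calc Rᵀ * (R * N * Rᵀ) * R = (Rᵀ * R) * N * (Rᵀ * R) := by simp only [Matrix.mul_assoc]
      _ = N := by rw [hR, Matrix.one_mul, Matrix.mul_one]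
  have h := congrFun (congrFun hN e) n
  simp only [Matrix.mul_apply, Matrix.transpose_apply, Matrix.of_apply, Finset.sum_mul, N] at h
  rw [← h, Finset.sum_comm]
  exact Finset.sum_congr rfl fun _ _ => Finset.sum_congr rfl fun _ _ => by ring

/-- The homogenised elasticity tensor of a rescaled and rotated cell is
obtained by rotating the homogenised tensor of the matrix cell:
C^H_{ijkl} = R_{ip}R_{jq}R_{ks}R_{lt}·Ĉ^H_{pqst}, independently of the scaling factor λ. -/
theorem homogenised_tensor_rotation
    (C : Fin 2 → Fin 2 → Fin 2 → Fin 2 → ℝ)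
    (R : Matrix (Fin 2) (Fin 2) ℝ) (hR : Rᵀ * R = 1)
    (hinv : ∀ i j k l,
      ∑ a : Fin 2, ∑ b : Fin 2, ∑ c : Fin 2, ∑ d : Fin 2,
        R i a * R j b * R k c * R l d * C a b c d = C i j k l)
    (lam : ℝ) (hlam : 0 < lam)
    (J : Fin 2 → Fin 2 → ℝ) (hJ : ∀ n t, J n t = (1 / lam) * R t n)
    (S : Set (EuclideanSpace ℝ (Fin 2))) (hS : MeasurableSet S) (hfin : volume S < ⊤)
    (ξhat : Fin 2 → Fin 2 → Fin 2 → EuclideanSpace ℝ (Fin 2) → ℝ)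
    (hsm : ∀ e c' d', ContDiff ℝ 1 (ξhat e c' d'))
    (hint : ∀ e c' d' t, IntegrableOn (fun Y => pd t (ξhat e c' d') Y) S volume)
    (ξ : Fin 2 → Fin 2 → Fin 2 → EuclideanSpace ℝ (Fin 2) → ℝ)
    (hξ : ∀ s k l Y, ξ s k l Y
      = lam * ∑ e : Fin 2, ∑ c' : Fin 2, ∑ d' : Fin 2,
          R s e * R k c' * R l d' * ξhat e c' d' Y)
    (Chat CH : Fin 2 → Fin 2 → Fin 2 → Fin 2 → ℝ)
    (hChat : ∀ i j k l, Chat i j k l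
      = C i j k l * (volume S).toReal
        - ∑ s : Fin 2, ∑ t : Fin 2, C i j s t * ∫ Y in S, pd t (ξhat s k l) Y)
    (hCH : ∀ i j k l, CH i j k l
      = C i j k l * (volume S).toReal
        - ∑ s : Fin 2, ∑ t : Fin 2, ∑ n : Fin 2,
            C i j s t * J n t * ∫ Y in S, pd n (ξ s k l) Y) :
    ∀ i j k l, CH i j k l
      = ∑ p : Fin 2, ∑ q : Fin 2, ∑ s : Fin 2, ∑ t : Fin 2,
          R i p * R j q * R k s * R l t * Chat p q s t := by
  have hI (s k l n : Fin 2) : ∫ Y in S, pd n (ξ s k l) Y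
      = lam * ∑ x : Fin 2 × Fin 2 × Fin 2,
          R s x.1 * R k x.2.1 * R l x.2.2 * ∫ Y in S, pd n (ξhat x.1 x.2.1 x.2.2) Y := by
    have hξ' : ξ s k l = fun Y => lam * ∑ x : Fin 2 × Fin 2 × Fin 2,
        R s x.1 * R k x.2.1 * R l x.2.2 * ξhat x.1 x.2.1 x.2.2 Y := by
      funext Y
      simp only [hξ, Fintype.sum_prod_type]
    simp_rw [hξ', pd_const_mul_sum n lam (fun x : Fin 2 × Fin 2 × Fin 2 =>
      R s x.1 * R k x.2.1 * R l x.2.2) (fun x => ξhat x.1 x.2.1 x.2.2) fun x => hsm _ _ _]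
    rw [integral_const_mul, integral_finsetSum _ fun x _ => (hint _ _ _ _).const_mul _]
    simp_rw [integral_const_mul]
  intro i j k l
  have hkey := sum_mul_orthogonal_eq_of_invariant C R hR hinv i j
  set I := fun e n c d => ∫ Y in S, pd n (ξhat e c d) Y with hIdef
  have hJI (s t n : Fin 2) : C i j s t * J n t * ∫ Y in S, pd n (ξ s k l) Y
      = ∑ e, C i j s t * R s e * R t n * ∑ c, ∑ d, R k c * R l d * I e n c d := by
    rw [hI, hJ]
    simp only [Fintype.sum_prod_type, Fin.sum_univ_two, hIdef]
    field_simp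
  have hL : CH i j k l = C i j k l * (volume S).toReal
      - ∑ e, ∑ n, (∑ p, ∑ q, R i p * R j q * C p q e n)
          * ∑ c, ∑ d, R k c * R l d * I e n c d := by
    simp_rw [hCH, hJI, ← hkey]
    simp only [Fin.sum_univ_two (M := ℝ)]
    ring
  rw [hL, ← hinv i j k l]
  simp only [hChat, Fin.sum_univ_two, hIdef]
  ring
end
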